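/- Let τ ∈ ℂ with Im τ > 0, q := e^{2πiτ}. Let u, v ∈ ℂ∖(ℤ+ℤτ) with 2u, 2v ∉ ℤ+ℤτ, and set x := e^{2πiu}, y := e^{2πiv}. Then the Weierstrass ℘-function for the lattice ℤ+ℤτ satisfies ℘(u) − ℘(v) = −4π² (q;q)_∞² Σ_{n∈ℤ} { ((1 + x q^n)/(1 − x q^n)) · x^{4n+1} q^{2n²}/θ(x²) − ((1 + y q^n)/(1 − y q^n)) · y^{4n+1} q^{2n²}/θ(y²) }, the bilateral sum being absolutely convergent. -/

import Mathlib

noncomputable section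

/-- `e z = exp(2πiz)`. -/
def e (z : ℂ) : ℂ := Complex.exp (2 * (Real.pi : ℂ) * Complex.I * z)

/-- Infinite q-Pochhammer symbol `(a;q)_∞`. -/
def qpinf (a q : ℂ) : ℂ := ∏' j : ℕ, (1 - a * q ^ j)

/-- `(a;q)_n` for `n : ℤ`, defined as `(a;q)_∞ / (a q^n;q)_∞`. -/
def qpint (a q : ℂ) (n : ℤ) : ℂ := qpinf a q / qpinf (a * q ^ n) q

/-- `θ(x) = (x;q)_∞ (q/x;q)_∞`. -/
def qtheta (q x : ℂ) : ℂ := qpinf x q * qpinf (q / x) q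

/-- Weierstrass ℘-function for the lattice ℤ+ℤτ. -/
def wp (τ u : ℂ) : ℂ :=
  1 / u ^ 2 + ∑' p : ℤ × ℤ,
    if p = (0, 0) then 0
    else 1 / (u - ((p.1 : ℂ) + (p.2 : ℂ) * τ)) ^ 2 - 1 / ((p.1 : ℂ) + (p.2 : ℂ) * τ) ^ 2

open Filter Topology

/-! ### The exponential `e` -/

theorem e_add (z w : ℂ) : e (z + w) = e z * e w := by
  simp only [e, mul_add, Complex.exp_add]

theorem e_zero : e 0 = 1 := by simp [e]

theorem e_ne_zero (z : ℂ) : e z ≠ 0 := Complex.exp_ne_zero _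

theorem e_neg (z : ℂ) : e (-z) = (e z)⁻¹ := by
  simp only [e, mul_neg, Complex.exp_neg]

theorem e_zpow (z : ℂ) (n : ℤ) : e z ^ n = e (n * z) := by
  rw [e, e, ← Complex.exp_int_mul]; ring_nf

theorem e_sq (z : ℂ) : e z ^ 2 = e (2 * z) := by exact_mod_cast e_zpow z 2

theorem e_eq_one_iff {z : ℂ} : e z = 1 ↔ ∃ n : ℤ, z = n := by
  rw [e, Complex.exp_eq_one_iff]
  refine exists_congr fun n => ⟨fun h => ?_, fun h => by rw [h]; ring⟩
  refine mul_left_cancel₀ Complex.two_pi_I_ne_zero ?_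
  rw [h]; ring

theorem e_one : e 1 = 1 := e_eq_one_iff.2 ⟨1, by simp⟩

theorem norm_e (z : ℂ) : ‖e z‖ = Real.exp (-(2 * Real.pi * z.im)) := by
  rw [e, Complex.norm_exp]; simp

theorem hasDerivAt_e (z : ℂ) : HasDerivAt e (2 * Real.pi * Complex.I * e z) z := by
  have h := ((hasDerivAt_id z).const_mul (2 * (Real.pi : ℂ) * Complex.I)).cexp
  simp only [id_eq, mul_one] at h
  rw [e, mul_comm]
  exact h

@[fun_prop]
theorem differentiable_e : Differentiable ℂ e := fun z => (hasDerivAt_e z).differentiableAt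

theorem norm_e_lt_one {τ : ℂ} (hτ : 0 < τ.im) : ‖e τ‖ < 1 := by
  rw [norm_e, Real.exp_lt_one_iff]
  have := mul_pos Real.two_pi_pos hτ
  linarith

/-! ### The infinite `q`-Pochhammer symbol -/

section Pochhammer

variable {q : ℂ}

theorem summable_norm_mul_pow (hq : ‖q‖ < 1) (a : ℂ) : Summable fun j : ℕ => ‖-(a * q ^ j)‖ := by
  simpa using (summable_geometric_of_lt_one (norm_nonneg _) hq).mul_left ‖a‖

theorem multipliable_one_sub_mul_pow (hq : ‖q‖ < 1) (a : ℂ) :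
    Multipliable fun j : ℕ => 1 - a * q ^ j := by
  simpa only [sub_eq_add_neg] using multipliable_one_add_of_summable (summable_norm_mul_pow hq a)

theorem qpinf_eq_mul (hq : ‖q‖ < 1) (a : ℂ) : qpinf a q = (1 - a) * qpinf (a * q) q := by
  have h0 : ∀ j : ℕ, 1 - a * q * q ^ j = 1 - a * q ^ (j + 1) := fun j => by
    rw [pow_succ', mul_assoc]
  have h := multipliable_one_sub_mul_pow hq (a * q)
  simp only [h0] at h
  have h1 := tprod_eq_zero_mul' (f := fun j : ℕ => 1 - a * q ^ j) h
  simp only [qpinf, h0, h1, pow_zero, mul_one]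

theorem qpinf_ne_zero (hq : ‖q‖ < 1) {a : ℂ} (h : ∀ j : ℕ, a * q ^ j ≠ 1) : qpinf a q ≠ 0 := by
  have := tprod_one_add_ne_zero_of_summable (f := fun j : ℕ => -(a * q ^ j))
    (fun j => by rw [← sub_eq_add_neg, sub_ne_zero]; exact (h j).symm) (summable_norm_mul_pow hq a)
  simpa [qpinf, sub_eq_add_neg] using this

theorem differentiable_qpinf (hq : ‖q‖ < 1) : Differentiable ℂ fun a => qpinf a q := by
  have h : HasProdLocallyUniformlyOn (fun (j : ℕ) a => 1 + -(a * q ^ j))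
      (fun a => ∏' j : ℕ, (1 + -(a * q ^ j))) Set.univ := by
    refine hasProdLocallyUniformlyOn_of_forall_compact isOpen_univ fun K _ hK => ?_
    obtain ⟨C, hC⟩ := hK.isBounded.exists_norm_le
    refine ((summable_geometric_of_lt_one (norm_nonneg _) hq).mul_left
      C).hasProdUniformlyOn_nat_one_add hK (.of_forall fun n x hx => ?_) fun n => by fun_prop
    rw [norm_neg, norm_mul, norm_pow]
    exact mul_le_mul_of_nonneg_right (hC x hx) (by positivity)
  have := h.differentiableOn (.of_forall fun s => by
    simpa [Finset.prod_fn] using DifferentiableOn.finsetProd (fun _ _ ↦ by fun_prop)) isOpen_univ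
  simpa [qpinf, sub_eq_add_neg, differentiableOn_univ] using this

theorem qpinf_self_ne_zero (hq : ‖q‖ < 1) : qpinf q q ≠ 0 := by
  refine qpinf_ne_zero hq fun j h => ?_
  rw [← pow_succ'] at h
  have h' := congrArg norm h
  rw [norm_pow, norm_one] at h'
  exact (pow_lt_one₀ (norm_nonneg q) hq j.succ_ne_zero).ne h'

/-! ### The theta function -/

theorem qtheta_mul_left (hq : ‖q‖ < 1) (hq0 : q ≠ 0) {x : ℂ} (hx : x ≠ 0) :
    qtheta q (q * x) = -(qtheta q x / x) := by
  have h1 := qpinf_eq_mul hq x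
  have h2 := qpinf_eq_mul hq (q / (q * x))
  have h3 : q / (q * x) * q = q / x := by field_simp
  rw [h3] at h2
  rw [qtheta, qtheta, h1, h2, mul_comm q x]
  field_simp
  ring

theorem qtheta_inv (hq : ‖q‖ < 1) {x : ℂ} (hx : x ≠ 0) :
    qtheta q x⁻¹ = -(qtheta q x / x) := by
  have h1 := qpinf_eq_mul hq x
  have h2 := qpinf_eq_mul hq x⁻¹
  rw [qtheta, qtheta, h1, h2, div_inv_eq_mul, mul_comm q x, inv_mul_eq_div]
  field_simp
  ring

theorem qtheta_ne_zero (hq : ‖q‖ < 1) {x : ℂ}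
    (h : ∀ n : ℤ, x * q ^ n ≠ 1) : qtheta q x ≠ 0 := by
  refine mul_ne_zero (qpinf_ne_zero hq fun j => by exact_mod_cast h j)
    (qpinf_ne_zero hq fun j hj => h (-(j + 1)) ?_)
  have hx : x ≠ 0 := by rintro rfl; simp at hj
  have hp : q ^ j * q = x := by field_simp at hj; linear_combination hj
  have hz : q ^ (-((j : ℤ) + 1)) = (q ^ j * q)⁻¹ := by
    rw [zpow_neg, ← pow_succ]; norm_cast
  rw [hz, hp, mul_inv_cancel₀ hx]

end Pochhammer

/-! ### The bilateral series -/

/-- The `n`-th term of the numerator series. -/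
def bilateralTerm (q x : ℂ) (n : ℤ) : ℂ :=
  (1 + x * q ^ n) / (1 - x * q ^ n) * (x ^ (4 * n + 1) * q ^ (2 * n ^ 2))

/-- The numerator series. -/
def bilateralSum (q x : ℂ) : ℂ := ∑' n : ℤ, bilateralTerm q x n

theorem bilateralSum_mul_left {q x : ℂ} (hq : q ≠ 0) (hx : x ≠ 0) :
    bilateralSum q (q * x) = bilateralSum q x / (q * x ^ 4) := by
  rw [bilateralSum, bilateralSum, ← tsum_div_const, ← (Equiv.subRight (1 : ℤ)).tsum_eq]
  refine tsum_congr fun n => ?_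
  have h1 : q * x * q ^ (n - 1) = x * q ^ n := by
    rw [zpow_sub_one₀ hq]; field_simp
  have h2 : (q * x) ^ (4 * (n - 1) + 1) * q ^ (2 * (n - 1) ^ 2) =
      x ^ (4 * n + 1) * q ^ (2 * n ^ 2) / (q * x ^ 4) := by
    rw [eq_div_iff (by positivity), mul_zpow]
    have h3 : x ^ (4 * (n - 1) + 1) * x ^ 4 = x ^ (4 * n + 1) := by
      rw [← zpow_natCast x 4, ← zpow_add₀ hx]; congr 1; push_cast; ring
    have h4 : q ^ (4 * (n - 1) + 1) * q ^ (2 * (n - 1) ^ 2) * q = q ^ (2 * n ^ 2) := by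
      rw [← zpow_add₀ hq, ← zpow_add_one₀ hq]; congr 1; ring
    linear_combination (q ^ (4 * (n - 1) + 1) * q ^ (2 * (n - 1) ^ 2) * q) * h3
      + x ^ (4 * n + 1) * h4
  simp only [bilateralTerm, Equiv.subRight_apply, h1, h2, mul_div_assoc]

theorem bilateralSum_inv {q x : ℂ} (hq : q ≠ 0) (hx : x ≠ 0) :
    bilateralSum q x⁻¹ = -(bilateralSum q x / x ^ 2) := by
  rw [bilateralSum, bilateralSum, ← tsum_div_const, ← tsum_neg, ← (Equiv.neg ℤ).tsum_eq]
  refine tsum_congr fun n => ?_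
  have h1 : x⁻¹ * q ^ (-n) = (x * q ^ n)⁻¹ := by rw [zpow_neg, mul_inv]
  have h2 : x⁻¹ ^ (4 * -n + 1) = x ^ (4 * n + 1) / x ^ 2 := by
    rw [inv_zpow, ← zpow_neg, ← zpow_natCast x 2, ← zpow_sub₀ hx]; congr 1; push_cast; ring
  have hz : x * q ^ n ≠ 0 := mul_ne_zero hx (zpow_ne_zero _ hq)
  have h3 : (1 + (x * q ^ n)⁻¹) / (1 - (x * q ^ n)⁻¹) = -((1 + x * q ^ n) / (1 - x * q ^ n)) := by
    generalize x * q ^ n = z at hz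
    by_cases h : z = 1
    · simp [h]
    · have : 1 - z ≠ 0 := sub_ne_zero.2 (Ne.symm h)
      have : z - 1 ≠ 0 := sub_ne_zero.2 h
      rw [← neg_sub z 1]
      field_simp
      ring
  simp only [bilateralTerm, Equiv.neg_apply, h1, h2, h3, neg_sq]
  ring

theorem norm_one_add_div_one_sub_le {z : ℂ} (hz : ‖z‖ ≤ 1 / 2 ∨ 2 ≤ ‖z‖) :
    ‖(1 + z) / (1 - z)‖ ≤ 3 := by
  have h1 : ‖1 + z‖ ≤ 1 + ‖z‖ := by simpa using norm_add_le 1 z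
  have h2 : 1 - ‖z‖ ≤ ‖1 - z‖ := by simpa using norm_sub_norm_le 1 z
  have h3 : ‖z‖ - 1 ≤ ‖1 - z‖ := by simpa [norm_sub_rev] using norm_sub_norm_le z 1
  have hpos : 0 < ‖1 - z‖ := by rcases hz with h | h <;> linarith
  rw [norm_div, div_le_iff₀ hpos]
  rcases hz with h | h <;> linarith

theorem zpow_mul_zpow_eq_jacobiTheta₂_term (τ u : ℂ) (n : ℤ) :
    e u ^ (4 * n + 1) * e τ ^ (2 * n ^ 2) = e u * jacobiTheta₂_term n (4 * u) (4 * τ) := by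
  rw [e_zpow, e_zpow, ← e_add, jacobiTheta₂_term, e, e, ← Complex.exp_add]
  congr 1
  push_cast
  ring

/-- A summable majorant of the numerator series on the strip `|Im u| ≤ M`. -/
def bilateralMajorant (τ : ℂ) (M : ℝ) (n : ℤ) : ℝ :=
  3 * (Real.exp (2 * Real.pi * M) *
    Real.exp (-Real.pi * (4 * τ.im * (n : ℝ) ^ 2 - 2 * (4 * M) * |n|)))

theorem summable_bilateralMajorant {τ : ℂ} (hτ : 0 < τ.im) (M : ℝ) :
    Summable (bilateralMajorant τ M) := by
  have := summable_pow_mul_jacobiTheta₂_term_bound (4 * M) (T := 4 * τ.im) (by positivity) 0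
  simp only [pow_zero, one_mul] at this
  exact (this.mul_left _).mul_left _

theorem norm_bilateralTerm_le {τ : ℂ} (hτ : 0 < τ.im) (M : ℝ) :
    ∀ᶠ n : ℤ in cofinite, ∀ u : ℂ, |u.im| ≤ M →
      ‖bilateralTerm (e τ) (e u) n‖ ≤ bilateralMajorant τ M n := by
  have hn : ∀ᶠ n : ℤ in cofinite, (M + 1) / τ.im ≤ |(n : ℝ)| :=
    (tendsto_norm_cocompact_atTop.comp Int.tendsto_coe_cofinite).eventually_ge_atTop _
  filter_upwards [hn] with n hn u hu
  rw [div_le_iff₀ hτ] at hn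
  rw [bilateralTerm, norm_mul, zpow_mul_zpow_eq_jacobiTheta₂_term, norm_mul]
  have him : |(4 * u).im| ≤ 4 * M := by
    simpa [abs_mul] using hu
  have hexp : (2 : ℝ) ≤ Real.exp (2 * Real.pi) := by
    have := Real.add_one_le_exp (2 * Real.pi)
    have := Real.pi_gt_three
    linarith
  have hpi := Real.pi_pos
  refine mul_le_mul (norm_one_add_div_one_sub_le ?_) (mul_le_mul ?_
    (norm_jacobiTheta₂_term_le (by positivity) him (by simp) n) (norm_nonneg _)
    (by positivity)) (by positivity) (by norm_num)
  · rw [e_zpow, ← e_add, norm_e]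
    have hi : (u + n * τ).im = u.im + n * τ.im := by simp
    rw [hi]
    rw [abs_le] at hu
    rcases le_total 0 (n : ℝ) with h0 | h0
    · left
      rw [abs_of_nonneg h0] at hn
      have : 2 * Real.pi * 1 ≤ 2 * Real.pi * (u.im + n * τ.im) :=
        mul_le_mul_of_nonneg_left (by linarith) (by positivity)
      rw [Real.exp_neg, one_div]
      exact inv_anti₀ two_pos (hexp.trans (Real.exp_le_exp.2 (by linarith)))
    · right
      rw [abs_of_nonpos h0] at hn
      have : 2 * Real.pi * 1 ≤ 2 * Real.pi * -(u.im + n * τ.im) :=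
        mul_le_mul_of_nonneg_left (by linarith) (by positivity)
      exact hexp.trans (Real.exp_le_exp.2 (by linarith))
  · rw [norm_e]
    refine Real.exp_le_exp.2 ?_
    have : 2 * Real.pi * -u.im ≤ 2 * Real.pi * M :=
      mul_le_mul_of_nonneg_left ((neg_le_abs _).trans hu) (by positivity)
    linarith

theorem summable_norm_bilateralTerm {τ : ℂ} (hτ : 0 < τ.im) (u : ℂ) :
    Summable fun n => ‖bilateralTerm (e τ) (e u) n‖ := by
  refine Summable.of_norm_bounded_eventually (summable_bilateralMajorant hτ |u.im|) ?_
  filter_upwards [norm_bilateralTerm_le hτ |u.im|] with n hn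
  simpa using hn u le_rfl

/-! ### The period lattice -/

/-- The periods `1` and `τ`. -/
def onePeriodPair (τ : ℂ) (hτ : 0 < τ.im) : PeriodPair where
  ω₁ := 1
  ω₂ := τ
  indep := by
    rw [LinearIndependent.pair_iff]
    intro s t h
    have him := congrArg Complex.im h
    have hre := congrArg Complex.re h
    simp at him hre
    have ht : t = 0 := him.resolve_right hτ.ne'
    subst ht
    simpa using hre

theorem mem_onePeriodPair_lattice {τ : ℂ} {hτ : 0 < τ.im} {z : ℂ} :
    z ∈ (onePeriodPair τ hτ).lattice ↔ ∃ m n : ℤ, z = m + n * τ := by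
  rw [PeriodPair.mem_lattice]
  simp [onePeriodPair, eq_comm]

theorem wp_eq_weierstrassP {τ : ℂ} (hτ : 0 < τ.im) (u : ℂ) :
    wp τ u = (onePeriodPair τ hτ).weierstrassP u := by
  have h := (onePeriodPair τ hτ).weierstrassPExcept_add 0 u
  rw [← h, PeriodPair.weierstrassPExcept, ← (onePeriodPair τ hτ).latticeEquivProd.symm.toEquiv.tsum_eq,
    wp, add_comm]
  have hz : ∀ p : ℤ × ℤ, (((onePeriodPair τ hτ).latticeEquivProd.symm p : _) : ℂ) = 0 ↔ p = (0, 0) := by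
    intro p
    rw [ZeroMemClass.coe_eq_zero, LinearEquiv.map_eq_zero_iff]
    rfl
  congr 1
  · refine tsum_congr fun p => ?_
    have hc := (onePeriodPair τ hτ).latticeEquiv_symm_apply p
    simp only [onePeriodPair, mul_one] at hc
    have := hz p
    simp only [LinearEquiv.coe_toEquiv, ZeroMemClass.coe_zero, this]
    congr 1
    erw [hc]
  · simp

theorem e_mul_zpow_eq_one_iff {τ u : ℂ} {n : ℤ} :
    e u * e τ ^ n = 1 ↔ ∃ m : ℤ, u = m + (-n : ℤ) * τ := by
  rw [e_zpow, ← e_add, e_eq_one_iff]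
  refine exists_congr fun m => ?_
  push_cast
  constructor <;> intro h <;> linear_combination h

theorem differentiableAt_tsum_bilateralTerm {τ : ℂ} (hτ : 0 < τ.im) (P : ℤ → Prop)
    [DecidablePred P] {u₀ : ℂ} (h : ∀ n, ¬P n → e u₀ * e τ ^ n ≠ 1) :
    DifferentiableAt ℂ (fun u => ∑' n, if P n then 0 else bilateralTerm (e τ) (e u) n) u₀ := by
  set Z : Set ℂ := {u | ∃ n, ¬P n ∧ e u * e τ ^ n = 1} with hZ
  have hZc : IsClosed Z := by
    refine (onePeriodPair τ hτ).isClosed_of_subset_lattice ?_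
    rintro u ⟨n, -, hn⟩
    obtain ⟨m, hm⟩ := e_mul_zpow_eq_one_iff.1 hn
    exact mem_onePeriodPair_lattice.2 ⟨m, -n, hm⟩
  set M := |u₀.im| + 1 with hM
  set U : Set ℂ := Zᶜ ∩ {u | |u.im| < M} with hU
  have hUo : IsOpen U := hZc.isOpen_compl.inter (isOpen_lt (by fun_prop) continuous_const)
  have hu₀ : u₀ ∈ U := ⟨fun ⟨n, hn, hn'⟩ => h n hn hn', by simp [hM]⟩
  have hunif : TendstoUniformlyOn
      (fun (s : Finset ℤ) u => ∑ n ∈ s, if P n then 0 else bilateralTerm (e τ) (e u) n)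
      (fun u => ∑' n, if P n then 0 else bilateralTerm (e τ) (e u) n) atTop U := by
    refine tendstoUniformlyOn_tsum_of_cofinite_eventually (summable_bilateralMajorant hτ M) ?_
    filter_upwards [norm_bilateralTerm_le hτ M] with n hn u hu
    have := hn u hu.2.le
    split_ifs
    · simpa using (norm_nonneg _).trans this
    · exact this
  refine (hunif.tendstoLocallyUniformlyOn.differentiableOn (.of_forall fun s => ?_) hUo
    ).differentiableAt (hUo.mem_nhds hu₀)
  refine DifferentiableOn.fun_sum fun n _ => ?_
  by_cases hP : P n
  · simp [hP]
  · simp only [hP, if_false]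
    intro u hu
    have h1 : 1 - e u * e τ ^ n ≠ 0 := fun h0 => hu.1 ⟨n, hP, (sub_eq_zero.1 h0).symm⟩
    have hd : DifferentiableAt ℂ (fun u => e u * e τ ^ n) u := (differentiable_e u).mul_const _
    exact (((hd.const_add 1).div (hd.const_sub 1) h1).mul
      (((differentiable_e u).zpow (.inl (e_ne_zero u))).mul_const _)).differentiableWithinAt

/-! ### Doubly periodic functions with removable singularities -/

theorem differentiable_limUnder_of_tendsto_zero {D : ℂ → ℂ}
    (hd : ∀ z, ∀ᶠ w in 𝓝[≠] z, DifferentiableAt ℂ D w)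
    (ht : ∀ z, Tendsto (fun w => (w - z) * D w) (𝓝[≠] z) (𝓝 0)) :
    Differentiable ℂ fun z => limUnder (𝓝[≠] z) D := by
  intro z
  obtain ⟨s, hs, hsd⟩ : ∃ s ∈ 𝓝 z, ∀ w ∈ s, w ≠ z → DifferentiableAt ℂ D w :=
    ⟨_, eventually_nhdsWithin_iff.1 (hd z), fun w hw hne => hw hne⟩
  have ho : (fun w => D w - D z) =o[𝓝[≠] z] fun w => (w - z)⁻¹ := by
    rw [Asymptotics.isLittleO_iff_tendsto']
    · have h0 : Tendsto (fun w => (w - z) * D z) (𝓝[≠] z) (𝓝 0) := by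
        have : ContinuousAt (fun w => (w - z) * D z) z := by fun_prop
        simpa using this.tendsto.mono_left nhdsWithin_le_nhds
      refine ((ht z).sub h0).congr' (.of_forall fun w => ?_) |>.trans (by simp)
      rw [div_inv_eq_mul]; ring
    · filter_upwards [self_mem_nhdsWithin] with w hw h0
      exact absurd (inv_eq_zero.1 h0) (sub_ne_zero.2 hw)
  have hu := Complex.differentiableOn_update_limUnder_of_isLittleO hs
    (fun w hw => (hsd w hw.1 hw.2).differentiableWithinAt) ho
  refine (hu.differentiableAt hs).congr_of_eventuallyEq ?_
  filter_upwards [hs] with w hw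
  by_cases h : w = z
  · subst h; simp
  · rw [Function.update_of_ne h]
    exact ((hsd w hw h).continuousAt.tendsto.mono_left nhdsWithin_le_nhds).limUnder_eq

theorem Function.Periodic.limUnder_nhdsNE {D : ℂ → ℂ} {p : ℂ} (h : Function.Periodic D p) :
    Function.Periodic (fun z => limUnder (𝓝[≠] z) D) p := by
  intro z
  have hm : map (· + p) (𝓝[≠] z) = 𝓝[≠] (z + p) :=
    (Homeomorph.addRight p).map_punctured_nhds_eq z
  simp only [limUnder, ← hm, Filter.map_map]
  congr 2
  exact funext h

theorem eq_of_periodic_of_differentiable {τ : ℂ} (hτ : 0 < τ.im) {E : ℂ → ℂ}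
    (hE : Differentiable ℂ E) (h1 : Function.Periodic E 1) (h2 : Function.Periodic E τ) (z w : ℂ) :
    E z = E w := by
  refine hE.apply_eq_apply_of_bounded ?_ z w
  set g : ℝ × ℝ → ℂ := fun p => E (p.1 + p.2 * τ) with hg
  have hK : IsCompact (g '' (Set.Icc 0 1 ×ˢ Set.Icc 0 1)) :=
    (isCompact_Icc.prod isCompact_Icc).image (hE.continuous.comp (by fun_prop))
  refine hK.isBounded.subset ?_
  rintro _ ⟨z, rfl⟩
  set b := z.im / τ.im with hb
  set a := z.re - b * τ.re with ha
  have hz : z = a + b * τ := by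
    apply Complex.ext
    · simp [ha]
    · simp [hb, hτ.ne']
  refine ⟨(Int.fract a, Int.fract b), ⟨⟨Int.fract_nonneg _, (Int.fract_lt_one _).le⟩,
    ⟨Int.fract_nonneg _, (Int.fract_lt_one _).le⟩⟩, ?_⟩
  have e1 := h1.int_mul ⌊a⌋ (Int.fract a + Int.fract b * τ)
  have e2 := h2.int_mul ⌊b⌋ (Int.fract a + Int.fract b * τ + ⌊a⌋ * 1)
  simp only [hg]
  rw [← e1, ← e2]
  congr 1
  conv_rhs => rw [hz, ← Int.fract_add_floor a, ← Int.fract_add_floor b]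
  push_cast
  ring

theorem eq_of_periodic_of_tendsto_zero {τ : ℂ} (hτ : 0 < τ.im) {D : ℂ → ℂ}
    (hd : ∀ z, ∀ᶠ w in 𝓝[≠] z, DifferentiableAt ℂ D w)
    (ht : ∀ z, Tendsto (fun w => (w - z) * D w) (𝓝[≠] z) (𝓝 0))
    (h1 : Function.Periodic D 1) (h2 : Function.Periodic D τ) {z w : ℂ}
    (hz : ContinuousAt D z) (hw : ContinuousAt D w) : D z = D w := by
  have h := eq_of_periodic_of_differentiable hτ (differentiable_limUnder_of_tendsto_zero hd ht)
    h1.limUnder_nhdsNE h2.limUnder_nhdsNE z w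
  rwa [(hz.tendsto.mono_left nhdsWithin_le_nhds).limUnder_eq,
    (hw.tendsto.mono_left nhdsWithin_le_nhds).limUnder_eq] at h

/-! ### The quotient of the bilateral series by the theta function -/

/-- The quotient of the bilateral series by `θ(x²)`, in the additive variable. -/
def bilateralQuot (τ u : ℂ) : ℂ := bilateralSum (e τ) (e u) / qtheta (e τ) (e u ^ 2)

theorem periodic_one_bilateralQuot (τ : ℂ) : Function.Periodic (bilateralQuot τ) 1 := fun u => by
  simp only [bilateralQuot, e_add, e_one, mul_one]

theorem periodic_bilateralQuot {τ : ℂ} (hτ : 0 < τ.im) :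
    Function.Periodic (bilateralQuot τ) τ := fun u => by
  have hq := norm_e_lt_one hτ
  have hq0 := e_ne_zero τ
  have hx := e_ne_zero u
  have h : (e τ * e u) ^ 2 = e τ * (e τ * e u ^ 2) := by ring
  rw [bilateralQuot, bilateralQuot, e_add, mul_comm (e u), bilateralSum_mul_left hq0 hx, h,
    qtheta_mul_left hq hq0 (by positivity), qtheta_mul_left hq hq0 (by positivity)]
  field_simp

theorem bilateralQuot_neg {τ : ℂ} (hτ : 0 < τ.im) (u : ℂ) :
    bilateralQuot τ (-u) = bilateralQuot τ u := by
  have hx := e_ne_zero u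
  rw [bilateralQuot, bilateralQuot, e_neg, bilateralSum_inv (e_ne_zero τ) hx, inv_pow,
    qtheta_inv (norm_e_lt_one hτ) (by positivity)]
  field_simp

theorem differentiableAt_bilateralSum {τ u : ℂ} (hτ : 0 < τ.im)
    (hu : ∀ m n : ℤ, u ≠ m + n * τ) :
    DifferentiableAt ℂ (fun u => bilateralSum (e τ) (e u)) u := by
  have := differentiableAt_tsum_bilateralTerm hτ (fun _ => False) (u₀ := u) fun n _ hn => by
    obtain ⟨m, hm⟩ := e_mul_zpow_eq_one_iff.1 hn
    exact hu _ _ hm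
  simpa [bilateralSum] using this

theorem differentiable_qtheta_e {τ : ℂ} (hτ : 0 < τ.im) :
    Differentiable ℂ fun u => qtheta (e τ) (e u ^ 2) := by
  have hd := differentiable_qpinf (norm_e_lt_one hτ)
  have h2 : Differentiable ℂ fun u => e τ / e u ^ 2 := fun u =>
    (differentiableAt_const _).div (by fun_prop) (pow_ne_zero 2 (e_ne_zero u))
  exact (hd.comp (f := fun u => e u ^ 2) (by fun_prop)).mul (hd.comp h2)

theorem differentiableAt_bilateralQuot {τ u : ℂ} (hτ : 0 < τ.im)
    (hu : ∀ m n : ℤ, 2 * u ≠ m + n * τ) : DifferentiableAt ℂ (bilateralQuot τ) u := by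
  refine (differentiableAt_bilateralSum hτ fun m n h => hu (2 * m) (2 * n) ?_).div
    (differentiable_qtheta_e hτ u) (qtheta_ne_zero (norm_e_lt_one hτ) fun n hn => ?_)
  · rw [h]; push_cast; ring
  · rw [e_sq] at hn
    obtain ⟨m, hm⟩ := e_mul_zpow_eq_one_iff.1 hn
    exact hu _ _ hm

/-- The cofactor of `1 - e(u)²` in `θ(e(u)²)`. -/
def thetaCofactor (τ u : ℂ) : ℂ := qpinf (e u ^ 2 * e τ) (e τ) * qpinf (e τ / e u ^ 2) (e τ)

theorem qtheta_e_eq {τ : ℂ} (hτ : 0 < τ.im) (u : ℂ) :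
    qtheta (e τ) (e u ^ 2) = (1 - e u) * (1 + e u) * thetaCofactor τ u := by
  rw [qtheta, thetaCofactor, qpinf_eq_mul (norm_e_lt_one hτ)]
  ring

theorem thetaCofactor_zero (τ : ℂ) : thetaCofactor τ 0 = qpinf (e τ) (e τ) ^ 2 := by
  simp [thetaCofactor, e_zero, sq]

theorem differentiable_thetaCofactor {τ : ℂ} (hτ : 0 < τ.im) :
    Differentiable ℂ (thetaCofactor τ) := by
  have hd := differentiable_qpinf (norm_e_lt_one hτ)
  have h2 : Differentiable ℂ fun u => e τ / e u ^ 2 := fun u =>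
    (differentiableAt_const _).div (by fun_prop) (pow_ne_zero 2 (e_ne_zero u))
  exact (hd.comp (f := fun u => e u ^ 2 * e τ) (by fun_prop)).mul (hd.comp h2)

theorem one_sub_e (t : ℂ) : 1 - e t = -(t * dslope e 0 t) := by
  have := sub_smul_dslope e 0 t
  rw [sub_zero, smul_eq_mul, e_zero] at this
  rw [this]; ring

theorem dslope_e_zero : dslope e 0 0 = 2 * Real.pi * Complex.I := by
  rw [dslope_same, (hasDerivAt_e 0).deriv, e_zero, mul_one]

theorem differentiable_dslope_e : Differentiable ℂ (dslope e 0) := by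
  rw [← differentiableOn_univ, Complex.differentiableOn_dslope univ_mem]
  exact differentiable_e.differentiableOn

theorem exists_tendsto_div_qtheta {τ : ℂ} (hτ : 0 < τ.im) :
    ∃ c, Tendsto (fun t => t / qtheta (e τ) (e t ^ 2)) (𝓝[≠] 0) (𝓝 c) := by
  have hc : ContinuousAt
      (fun t => -1 / (dslope e 0 t * (1 + e t) * thetaCofactor τ t)) 0 := by
    have h1 := differentiable_dslope_e.continuous.continuousAt (x := 0)
    have h2 := differentiable_e.continuous.continuousAt (x := 0)
    have h3 := (differentiable_thetaCofactor hτ).continuous.continuousAt (x := 0)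
    refine continuousAt_const.div ((h1.mul (continuousAt_const.add h2)).mul h3) ?_
    rw [dslope_e_zero, e_zero, thetaCofactor_zero]
    exact mul_ne_zero (mul_ne_zero Complex.two_pi_I_ne_zero (by norm_num))
      (pow_ne_zero 2 (qpinf_self_ne_zero (norm_e_lt_one hτ)))
  refine ⟨_, (hc.tendsto.mono_left nhdsWithin_le_nhds).congr' ?_⟩
  filter_upwards [self_mem_nhdsWithin] with t ht
  rw [qtheta_e_eq hτ, one_sub_e]
  rw [show -(t * dslope e 0 t) * (1 + e t) * thetaCofactor τ t =
    t * -(dslope e 0 t * (1 + e t) * thetaCofactor τ t) by ring, div_mul_eq_div_div t t, div_self ht,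
    div_neg, neg_div]

theorem exists_tendsto_mul_bilateralQuot {τ z : ℂ} (hτ : 0 < τ.im)
    (hz : ∀ m n : ℤ, z ≠ m + n * τ) (hz2 : e z ^ 2 = 1 ∨ e z ^ 2 = e τ) :
    ∃ c, Tendsto (fun t => t * bilateralQuot τ (z + t)) (𝓝[≠] 0) (𝓝 c) := by
  obtain ⟨c, hc⟩ := exists_tendsto_div_qtheta hτ
  have hN : Tendsto (fun t => bilateralSum (e τ) (e (z + t))) (𝓝[≠] 0)
      (𝓝 (bilateralSum (e τ) (e (z + 0)))) := by
    have h := (differentiableAt_bilateralSum hτ hz).continuousAt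
    have : ContinuousAt (fun t => bilateralSum (e τ) (e (z + t))) 0 :=
      ContinuousAt.comp (f := fun t => z + t) (g := fun u => bilateralSum (e τ) (e u))
        (by simpa using h) (by fun_prop)
    exact this.tendsto.mono_left nhdsWithin_le_nhds
  rcases hz2 with h | h
  · refine ⟨_, (hN.mul hc).congr fun t => ?_⟩
    rw [bilateralQuot, e_add z t, mul_pow, h, one_mul]
    ring
  · have he : Tendsto (fun t => -e t ^ 2) (𝓝[≠] 0) (𝓝 (-e 0 ^ 2)) := by
      have : Continuous fun t => -e t ^ 2 := (differentiable_e.continuous.pow 2).neg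
      exact this.continuousAt.tendsto.mono_left nhdsWithin_le_nhds
    refine ⟨_, ((hN.mul hc).mul he).congr fun t => ?_⟩
    rw [bilateralQuot, e_add z t, mul_pow, h, qtheta_mul_left (norm_e_lt_one hτ) (e_ne_zero τ)
      (pow_ne_zero 2 (e_ne_zero t)), div_neg, div_div_eq_mul_div]
    ring

/-- The function `t² F(t)`, where `F` is the quotient of the bilateral series by `θ(e(t)²)`,
without its removable singularity at `0`. -/
def regularizedQuot (τ t : ℂ) : ℂ :=
  (e t + (∑' n, if n = 0 then 0 else bilateralTerm (e τ) (e t) n) * ((1 - e t) / (1 + e t))) /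
    (dslope e 0 t ^ 2 * thetaCofactor τ t)

theorem regularizedQuot_zero (τ : ℂ) :
    regularizedQuot τ 0 = 1 / ((2 * Real.pi * Complex.I) ^ 2 * qpinf (e τ) (e τ) ^ 2) := by
  rw [regularizedQuot, dslope_e_zero, thetaCofactor_zero, e_zero]
  simp

theorem differentiableAt_regularizedQuot {τ : ℂ} (hτ : 0 < τ.im) :
    DifferentiableAt ℂ (regularizedQuot τ) 0 := by
  have h0 : DifferentiableAt ℂ
      (fun t => ∑' n : ℤ, if n = 0 then 0 else bilateralTerm (e τ) (e t) n) 0 := by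
    refine differentiableAt_tsum_bilateralTerm hτ (fun n => n = 0) fun n hn h => ?_
    obtain ⟨m, hm⟩ := e_mul_zpow_eq_one_iff.1 h
    have him := congrArg Complex.im hm
    simp [hτ.ne', hn] at him
  have h1 := differentiable_e 0
  refine (h1.add (h0.mul ((h1.const_sub 1).div (h1.const_add 1) ?_))).div
    (((differentiable_dslope_e 0).pow 2).mul (differentiable_thetaCofactor hτ 0)) ?_
  · rw [e_zero]; norm_num
  · rw [dslope_e_zero, thetaCofactor_zero]
    exact mul_ne_zero (pow_ne_zero 2 Complex.two_pi_I_ne_zero)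
      (pow_ne_zero 2 (qpinf_self_ne_zero (norm_e_lt_one hτ)))

theorem sq_mul_bilateralQuot {τ : ℂ} (hτ : 0 < τ.im) :
    ∀ᶠ t in 𝓝[≠] 0, t ^ 2 * bilateralQuot τ t = regularizedQuot τ t := by
  have hadd : ∀ᶠ t in 𝓝 (0 : ℂ), 1 + e t ≠ 0 := by
    have : ContinuousAt (fun t => 1 + e t) 0 :=
      continuousAt_const.add differentiable_e.continuous.continuousAt
    refine this.eventually_ne ?_
    rw [e_zero]; norm_num
  have hslope : ∀ᶠ t in 𝓝 (0 : ℂ), dslope e 0 t ≠ 0 := by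
    refine differentiable_dslope_e.continuous.continuousAt.eventually_ne ?_
    rw [dslope_e_zero]
    exact Complex.two_pi_I_ne_zero
  filter_upwards [nhdsWithin_le_nhds hadd, nhdsWithin_le_nhds hslope, self_mem_nhdsWithin]
    with t h1 h2 ht
  have ht : t ≠ 0 := ht
  have hsum : bilateralSum (e τ) (e t) = (1 + e t) / (1 - e t) * e t +
      ∑' n : ℤ, if n = 0 then 0 else bilateralTerm (e τ) (e t) n := by
    rw [bilateralSum, (summable_norm_bilateralTerm hτ t).of_norm.tsum_eq_add_tsum_ite 0]
    simp [bilateralTerm]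
  rw [bilateralQuot, qtheta_e_eq hτ, hsum, regularizedQuot]
  generalize (∑' n : ℤ, if n = 0 then 0 else bilateralTerm (e τ) (e t) n) = S
  generalize thetaCofactor τ t = P
  rw [one_sub_e]
  by_cases hP : P = 0
  · simp [hP]
  field_simp
  ring

/-! ### Comparison with `℘` -/

/-- The difference between the multiple of the quotient with principal part `1 / u²` and `℘`. -/
def wpDefect (τ u : ℂ) : ℂ :=
  -4 * (Real.pi : ℂ) ^ 2 * qpinf (e τ) (e τ) ^ 2 * bilateralQuot τ u - wp τ u

theorem periodic_wp {τ : ℂ} (hτ : 0 < τ.im) (m n : ℤ) : Function.Periodic (wp τ) (m + n * τ) := by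
  rw [show wp τ = (onePeriodPair τ hτ).weierstrassP from funext (wp_eq_weierstrassP hτ)]
  exact (onePeriodPair τ hτ).periodic_weierstrassP ⟨_, mem_onePeriodPair_lattice.2 ⟨m, n, rfl⟩⟩

theorem periodic_one_wpDefect {τ : ℂ} (hτ : 0 < τ.im) : Function.Periodic (wpDefect τ) 1 := by
  intro u
  have h := periodic_wp hτ 1 0 u
  simp only [Int.cast_one, Int.cast_zero, zero_mul, add_zero] at h
  rw [wpDefect, wpDefect, h, periodic_one_bilateralQuot]

theorem periodic_wpDefect {τ : ℂ} (hτ : 0 < τ.im) : Function.Periodic (wpDefect τ) τ := by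
  intro u
  have h := periodic_wp hτ 0 1 u
  simp only [Int.cast_one, Int.cast_zero, one_mul, zero_add] at h
  rw [wpDefect, wpDefect, h, periodic_bilateralQuot hτ]

theorem wpDefect_add {τ : ℂ} (hτ : 0 < τ.im) (u : ℂ) (m n : ℤ) :
    wpDefect τ (u + (m + n * τ)) = wpDefect τ u := by
  have h1 := (periodic_one_wpDefect hτ).int_mul m u
  have h2 := (periodic_wpDefect hτ).int_mul n (u + m * 1)
  rw [← h1, ← h2]
  congr 1
  ring

theorem wpDefect_neg {τ : ℂ} (hτ : 0 < τ.im) (u : ℂ) : wpDefect τ (-u) = wpDefect τ u := by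
  rw [wpDefect, wpDefect, bilateralQuot_neg hτ, wp_eq_weierstrassP hτ, wp_eq_weierstrassP hτ,
    PeriodPair.weierstrassP_neg]

theorem differentiableAt_wp {τ u : ℂ} (hτ : 0 < τ.im) (hu : ∀ m n : ℤ, u ≠ m + n * τ) :
    DifferentiableAt ℂ (wp τ) u := by
  rw [show wp τ = (onePeriodPair τ hτ).weierstrassP from funext (wp_eq_weierstrassP hτ)]
  refine (onePeriodPair τ hτ).differentiableOn_weierstrassP.differentiableAt
    ((onePeriodPair τ hτ).isClosed_lattice.isOpen_compl.mem_nhds fun h => ?_)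
  obtain ⟨m, n, h⟩ := mem_onePeriodPair_lattice.1 h
  exact hu m n h

theorem differentiableAt_wpDefect {τ u : ℂ} (hτ : 0 < τ.im)
    (hu : ∀ m n : ℤ, 2 * u ≠ m + n * τ) : DifferentiableAt ℂ (wpDefect τ) u := by
  refine ((differentiableAt_bilateralQuot hτ hu).const_mul _).sub
    (differentiableAt_wp hτ fun m n h => hu (2 * m) (2 * n) ?_)
  rw [h]; push_cast; ring

theorem eventually_differentiableAt_wpDefect {τ : ℂ} (hτ : 0 < τ.im) (z : ℂ) :
    ∀ᶠ w in 𝓝[≠] z, DifferentiableAt ℂ (wpDefect τ) w := by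
  have h := (onePeriodPair τ hτ).compl_lattice_sdiff_singleton_mem_nhds (2 * z)
  have hc : ContinuousAt (fun w : ℂ => 2 * w) z := by fun_prop
  filter_upwards [nhdsWithin_le_nhds (hc.preimage_mem_nhds h), self_mem_nhdsWithin] with w hw hne
  refine differentiableAt_wpDefect hτ fun m n hmn => hw ⟨?_, fun h => hne ?_⟩
  · exact mem_onePeriodPair_lattice.2 ⟨m, n, hmn⟩
  · exact mul_left_cancel₀ two_ne_zero h

theorem exists_tendsto_mul_wpDefect_zero {τ : ℂ} (hτ : 0 < τ.im) :
    ∃ c, Tendsto (fun t => t * wpDefect τ (0 + t)) (𝓝[≠] 0) (𝓝 c) := by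
  set C : ℂ := -4 * (Real.pi : ℂ) ^ 2 * qpinf (e τ) (e τ) ^ 2 with hC
  set L := onePeriodPair τ hτ with hL
  have hG0 : C * regularizedQuot τ 0 = 1 := by
    have hQ := qpinf_self_ne_zero (norm_e_lt_one hτ)
    have hpi : (Real.pi : ℂ) ≠ 0 := by exact_mod_cast Real.pi_ne_zero
    rw [regularizedQuot_zero, hC, mul_pow _ Complex.I, Complex.I_sq]
    field_simp
    norm_num
  have hslope := hasDerivAt_iff_tendsto_slope.1
    ((differentiableAt_regularizedQuot hτ).const_mul C).hasDerivAt
  have hP : Tendsto (fun t => t * L.weierstrassPExcept 0 t) (𝓝[≠] 0) (𝓝 0) := by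
    have : ContinuousAt (fun t => t * L.weierstrassPExcept 0 t) 0 :=
      continuousAt_id.mul (L.analyticAt_weierstrassPExcept 0).continuousAt
    simpa using this.tendsto.mono_left nhdsWithin_le_nhds
  refine ⟨_, (hslope.sub hP).congr' ?_⟩
  filter_upwards [sq_mul_bilateralQuot hτ, self_mem_nhdsWithin] with t ht ht0
  have ht0 : t ≠ 0 := ht0
  have hwp : wp τ t = L.weierstrassPExcept 0 t + 1 / t ^ 2 := by
    rw [wp_eq_weierstrassP hτ, ← L.weierstrassPExcept_add 0 t]
    simp
  rw [slope_def_field, hG0, ← ht, zero_add, wpDefect, ← hC, hwp]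
  field_simp
  ring

theorem exists_tendsto_mul_wpDefect_of_half {τ z : ℂ} (hτ : 0 < τ.im)
    (hz : ∀ m n : ℤ, z ≠ m + n * τ) (hz2 : e z ^ 2 = 1 ∨ e z ^ 2 = e τ) :
    ∃ c, Tendsto (fun t => t * wpDefect τ (z + t)) (𝓝[≠] 0) (𝓝 c) := by
  obtain ⟨c, hc⟩ := exists_tendsto_mul_bilateralQuot hτ hz hz2
  have hP : Tendsto (fun t => t * wp τ (z + t)) (𝓝[≠] 0) (𝓝 (0 * wp τ (z + 0))) := by
    have h : ContinuousAt (fun t => wp τ (z + t)) 0 :=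
      ContinuousAt.comp (f := fun t => z + t) (g := wp τ)
        (by simpa using (differentiableAt_wp hτ hz).continuousAt) (by fun_prop)
    exact (continuousAt_id.mul h).tendsto.mono_left nhdsWithin_le_nhds
  refine ⟨_, ((hc.const_mul (-4 * (Real.pi : ℂ) ^ 2 * qpinf (e τ) (e τ) ^ 2)).sub hP).congr
    fun t => ?_⟩
  rw [wpDefect]
  ring

theorem exists_tendsto_mul_wpDefect {τ z : ℂ} (hτ : 0 < τ.im) {m n : ℤ}
    (hz : 2 * z = m + n * τ) :
    ∃ c, Tendsto (fun t => t * wpDefect τ (z + t)) (𝓝[≠] 0) (𝓝 c) := by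
  set a : ℤ := m % 2 with ha
  set b : ℤ := n % 2 with hb
  have hm : (m : ℂ) = a + 2 * (m / 2 : ℤ) := by exact_mod_cast (Int.emod_add_mul_ediv m 2).symm
  have hn : (n : ℂ) = b + 2 * (n / 2 : ℤ) := by exact_mod_cast (Int.emod_add_mul_ediv n 2).symm
  set z₀ : ℂ := (a + b * τ) / 2 with hz₀
  have hzz : z = z₀ + ((m / 2 : ℤ) + (n / 2 : ℤ) * τ) := by
    rw [hz₀]
    linear_combination (1 / 2 : ℂ) * hz + (1 / 2 : ℂ) * hm + (1 / 2 : ℂ) * τ * hn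
  suffices h : ∃ c, Tendsto (fun t => t * wpDefect τ (z₀ + t)) (𝓝[≠] 0) (𝓝 c) by
    obtain ⟨c, hc⟩ := h
    refine ⟨c, hc.congr fun t => ?_⟩
    rw [hzz, add_right_comm, wpDefect_add hτ]
  have he : e z₀ ^ 2 = e τ ^ b := by
    rw [e_sq, e_zpow, hz₀, mul_div_cancel₀ _ two_ne_zero, e_add, e_eq_one_iff.2 ⟨a, rfl⟩, one_mul]
  by_cases h00 : a = 0 ∧ b = 0
  · have : z₀ = 0 := by simp [hz₀, h00.1, h00.2]
    rw [this]
    exact exists_tendsto_mul_wpDefect_zero hτ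
  refine exists_tendsto_mul_wpDefect_of_half hτ (fun k l hkl => h00 ?_) ?_
  · have h2 : (a : ℂ) + b * τ = 2 * k + 2 * l * τ := by
      rw [hz₀] at hkl
      linear_combination 2 * hkl
    have him : (b : ℝ) * τ.im = 2 * l * τ.im := by simpa using congrArg Complex.im h2
    have hbl : (b : ℝ) = 2 * l := mul_right_cancel₀ hτ.ne' him
    have hre : (a : ℝ) + b * τ.re = 2 * k + 2 * l * τ.re := by simpa using congrArg Complex.re h2
    have hak : (a : ℝ) = 2 * k := by rw [hbl] at hre; linarith
    have hbl' : b = 2 * l := by exact_mod_cast hbl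
    have hak' : a = 2 * k := by exact_mod_cast hak
    omega
  · rw [he]
    rcases Int.emod_two_eq_zero_or_one n with h | h
    · left; rw [hb, h, zpow_zero]
    · right; rw [hb, h, zpow_one]

theorem tendsto_mul_wpDefect {τ : ℂ} (hτ : 0 < τ.im) (z : ℂ) :
    Tendsto (fun w => (w - z) * wpDefect τ w) (𝓝[≠] z) (𝓝 0) := by
  by_cases h : ∃ m n : ℤ, 2 * z = m + n * τ
  · obtain ⟨m, n, hz⟩ := h
    obtain ⟨c, hc⟩ := exists_tendsto_mul_wpDefect hτ hz
    have hodd : ∀ t, wpDefect τ (z + -t) = wpDefect τ (z + t) := fun t => by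
      rw [← wpDefect_neg hτ (z + -t), ← wpDefect_add hτ (-(z + -t)) m n, ← hz]
      congr 1
      ring
    have hneg : Tendsto (fun t : ℂ => -t) (𝓝[≠] 0) (𝓝[≠] 0) := by
      refine tendsto_nhdsWithin_iff.2 ⟨?_, ?_⟩
      · have : ContinuousAt (fun t : ℂ => -t) 0 := by fun_prop
        simpa using this.tendsto.mono_left nhdsWithin_le_nhds
      · filter_upwards [self_mem_nhdsWithin] with t ht
        simpa using ht
    have hc' : Tendsto (fun t => t * wpDefect τ (z + t)) (𝓝[≠] 0) (𝓝 (-c)) := by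
      refine (hc.comp hneg).neg.congr fun t => ?_
      simp only [Function.comp_apply, hodd]
      ring
    have hc0 : c = 0 := self_eq_neg.1 (tendsto_nhds_unique hc hc')
    subst hc0
    have hsub : Tendsto (fun w : ℂ => w - z) (𝓝[≠] z) (𝓝[≠] 0) := by
      refine tendsto_nhdsWithin_iff.2 ⟨?_, ?_⟩
      · have : ContinuousAt (fun w : ℂ => w - z) z := by fun_prop
        simpa using this.tendsto.mono_left nhdsWithin_le_nhds
      · filter_upwards [self_mem_nhdsWithin] with t ht
        exact sub_ne_zero.2 ht
    refine (hc.comp hsub).congr fun w => ?_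
    simp
  · push Not at h
    have : ContinuousAt (fun w => (w - z) * wpDefect τ w) z :=
      ContinuousAt.mul (by fun_prop) (differentiableAt_wpDefect hτ h).continuousAt
    simpa using this.tendsto.mono_left nhdsWithin_le_nhds

theorem stmt15 (τ u v : ℂ) (hτ : 0 < τ.im)
    (hu : ∀ m n : ℤ, u ≠ (m : ℂ) + (n : ℂ) * τ)
    (hv : ∀ m n : ℤ, v ≠ (m : ℂ) + (n : ℂ) * τ)
    (hu2 : ∀ m n : ℤ, 2 * u ≠ (m : ℂ) + (n : ℂ) * τ)
    (hv2 : ∀ m n : ℤ, 2 * v ≠ (m : ℂ) + (n : ℂ) * τ)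
    (q x y : ℂ) (hq : q = e τ) (hx : x = e u) (hy : y = e v) :
    Summable (fun n : ℤ =>
      ‖(1 + x * q ^ n) / (1 - x * q ^ n) * (x ^ (4 * n + 1) * q ^ (2 * n ^ 2)) /
          qtheta q (x ^ 2)
        - (1 + y * q ^ n) / (1 - y * q ^ n) * (y ^ (4 * n + 1) * q ^ (2 * n ^ 2)) /
          qtheta q (y ^ 2)‖) ∧
    wp τ u - wp τ v =
      -4 * (Real.pi : ℂ) ^ 2 * qpinf q q ^ 2 *
        ∑' n : ℤ,
          ((1 + x * q ^ n) / (1 - x * q ^ n) * (x ^ (4 * n + 1) * q ^ (2 * n ^ 2)) /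
              qtheta q (x ^ 2)
            - (1 + y * q ^ n) / (1 - y * q ^ n) * (y ^ (4 * n + 1) * q ^ (2 * n ^ 2)) /
              qtheta q (y ^ 2)) := by
  subst hq hx hy
  have su : Summable fun n : ℤ => bilateralTerm (e τ) (e u) n / qtheta (e τ) (e u ^ 2) :=
    (summable_norm_bilateralTerm hτ u).of_norm.div_const _
  have sv : Summable fun n : ℤ => bilateralTerm (e τ) (e v) n / qtheta (e τ) (e v ^ 2) :=
    (summable_norm_bilateralTerm hτ v).of_norm.div_const _
  refine ⟨(su.sub sv).norm, ?_⟩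
  have h := eq_of_periodic_of_tendsto_zero hτ (eventually_differentiableAt_wpDefect hτ)
    (tendsto_mul_wpDefect hτ) (periodic_one_wpDefect hτ) (periodic_wpDefect hτ)
    (differentiableAt_wpDefect hτ hu2).continuousAt (differentiableAt_wpDefect hτ hv2).continuousAt
  have hs := su.tsum_sub sv
  rw [tsum_div_const, tsum_div_const] at hs
  simp only [bilateralTerm] at hs
  rw [hs]
  simp only [wpDefect, bilateralQuot, bilateralSum, bilateralTerm] at h
  linear_combination -h
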